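/- Let p be a k-homogeneous Cl^s-valued monogenic polynomial on ℝ^m (∂p = 0), and write its restriction to {x_m = 0} as p_0(x̲) = u_0(x̲) + v_0(x̲)e_m with u_0 valued in Cl^s_{m-1} and v_0 valued in Cl^{s-1}_{m-1} (s-vectors resp. (s-1)-vectors built from e_1,...,e_{m-1}). Then u_0 and v_0 satisfy the compatibility conditions ∂̲^+u_0 = 0 and ∂̲^-v_0 = 0. -/

import Mathlib

noncomputable section
open scoped TensorProduct
open CliffordAlgebra MvPolynomial

/-- The quadratic form of signature (0,m): Q(x) = -|x|². -/
def Qf (m : ℕ) : QuadraticForm ℝ (Fin m → ℝ) :=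
  - QuadraticMap.weightedSumSquares ℝ (fun _ : Fin m => (1 : ℝ))

/-- The real Clifford algebra Cl(0,m). -/
abbrev Cl (m : ℕ) := CliffordAlgebra (Qf m)

/-- The generators e₁,…,e_m. -/
def e (m : ℕ) (i : Fin m) : Cl m := CliffordAlgebra.ι (Qf m) (Pi.single i 1)

/-- Left outer (wedge) multiplication by `c`:  v ↦ (1/2)(c v + α(v) c). -/
def wedgeL (m : ℕ) (c : Cl m) : Cl m →ₗ[ℝ] Cl m :=
  (1/2 : ℝ) • (LinearMap.mulLeft ℝ c +
    (LinearMap.mulRight ℝ c) ∘ₗ (involute (Q := Qf m)).toLinearMap)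

/-- Left inner (dot) multiplication by `c`:  v ↦ (1/2)(c v - α(v) c). -/
def dotL (m : ℕ) (c : Cl m) : Cl m →ₗ[ℝ] Cl m :=
  (1/2 : ℝ) • (LinearMap.mulLeft ℝ c -
    (LinearMap.mulRight ℝ c) ∘ₗ (involute (Q := Qf m)).toLinearMap)

/-- Scalar polynomials on ℝ^m. -/
abbrev Pm (m : ℕ) := MvPolynomial (Fin m) ℝ

/-- The space P* of Cl(0,m)-valued polynomials on ℝ^m. -/
abbrev MS (m : ℕ) := Pm m ⊗[ℝ] Cl m

/-- Build an operator on Cl-valued polynomials from operators on each factor. -/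
def op (m : ℕ) (f : Pm m →ₗ[ℝ] Pm m) (g : Cl m →ₗ[ℝ] Cl m) : Module.End ℝ (MS m) :=
  TensorProduct.map f g

/-- The operator (x∧) of outer multiplication by the vector variable. -/
def xWedge (m : ℕ) : Module.End ℝ (MS m) :=
  ∑ j : Fin m, op m (LinearMap.mulLeft ℝ (X j)) (wedgeL m (e m j))

/-- The operator (x•) of inner multiplication by the vector variable. -/
def xDot (m : ℕ) : Module.End ℝ (MS m) :=
  ∑ j : Fin m, op m (LinearMap.mulLeft ℝ (X j)) (dotL m (e m j))

/-- Left Clifford multiplication by the vector variable x. -/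
def Xmul (m : ℕ) : Module.End ℝ (MS m) :=
  ∑ j : Fin m, op m (LinearMap.mulLeft ℝ (X j)) (LinearMap.mulLeft ℝ (e m j))

/-- The Dirac operator ∂ = Σ e_j ∂_{x_j}. -/
def Dirac (m : ℕ) : Module.End ℝ (MS m) :=
  ∑ j : Fin m, op m (pderiv j).toLinearMap (LinearMap.mulLeft ℝ (e m j))

/-- The exterior part ∂⁺ of the Dirac operator. -/
def dplus (m : ℕ) : Module.End ℝ (MS m) :=
  ∑ j : Fin m, op m (pderiv j).toLinearMap (wedgeL m (e m j))

/-- The interior part ∂⁻ of the Dirac operator. -/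
def dminus (m : ℕ) : Module.End ℝ (MS m) :=
  ∑ j : Fin m, op m (pderiv j).toLinearMap (dotL m (e m j))

/-- The Euler operator E = Σ x_j ∂_{x_j}. -/
def Euler (m : ℕ) : Module.End ℝ (MS m) :=
  ∑ j : Fin m, op m (LinearMap.mulLeft ℝ (X j) ∘ₗ (pderiv j).toLinearMap) LinearMap.id

/-- The fermionic Euler operator ∂⁺⌋ = -Σ (e_j∧)(e_j•). -/
def fermPlus (m : ℕ) : Module.End ℝ (MS m) :=
  - ∑ j : Fin m, op m LinearMap.id (wedgeL m (e m j) ∘ₗ dotL m (e m j))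

/-- The fermionic Euler operator ∂⁻⌋ = -Σ (e_j•)(e_j∧). -/
def fermMinus (m : ℕ) : Module.End ℝ (MS m) :=
  - ∑ j : Fin m, op m LinearMap.id (dotL m (e m j) ∘ₗ wedgeL m (e m j))

/-- The Laplacian Δ = Σ ∂_{x_j}². -/
def Lap (m : ℕ) : Module.End ℝ (MS m) :=
  ∑ j : Fin m, op m ((pderiv j).toLinearMap ∘ₗ (pderiv j).toLinearMap) LinearMap.id

/-- Multiplication by the Clifford square x² = -(x₁²+⋯+x_m²) of the vector variable. -/
def Mx2 (m : ℕ) : Module.End ℝ (MS m) :=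
  op m (LinearMap.mulLeft ℝ (-(∑ j : Fin m, (X j : Pm m) ^ 2))) LinearMap.id

/-- The space Cl^s of s-vectors: the span of products of s distinct generators. -/
def clGrade (m s : ℕ) : Submodule ℝ (Cl m) :=
  Submodule.span ℝ
    {x | ∃ l : List (Fin m), l.length = s ∧ l.Nodup ∧ x = (l.map (e m)).prod}

/-- The space P_k^s of k-homogeneous s-vector valued polynomials. -/
def Pks (m k s : ℕ) : Submodule ℝ (MS m) :=
  LinearMap.range (TensorProduct.map
    (MvPolynomial.homogeneousSubmodule (Fin m) ℝ k).subtype (clGrade m s).subtype)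

/-- The space of s-vector valued polynomials (no homogeneity). -/
def PsVal (m s : ℕ) : Submodule ℝ (MS m) :=
  LinearMap.range (TensorProduct.map (LinearMap.id : Pm m →ₗ[ℝ] Pm m) (clGrade m s).subtype)

/-- Homogeneous solutions of the Hodge–de Rham system: ∂⁺P = 0 and ∂⁻P = 0. -/
def Hks (m k s : ℕ) : Submodule ℝ (MS m) :=
  Pks m k s ⊓ LinearMap.ker (dplus m) ⊓ LinearMap.ker (dminus m)

/-- Homogeneous s-vector valued monogenic polynomials: ∂P = 0. -/
def HksD (m k s : ℕ) : Submodule ℝ (MS m) :=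
  Pks m k s ⊓ LinearMap.ker (Dirac m)

/-- Ker_k^s ∂⁺. -/
def KerP (m k s : ℕ) : Submodule ℝ (MS m) :=
  Pks m k s ⊓ LinearMap.ker (dplus m)

/-- Ker_k^s ∂⁻. -/
def KerM (m k s : ℕ) : Submodule ℝ (MS m) :=
  Pks m k s ⊓ LinearMap.ker (dminus m)

end
noncomputable section
open scoped TensorProduct
open CliffordAlgebra MvPolynomial

/-- Restriction to the hyperplane x_m = 0 (substitution x_m := 0). -/
def Ev0 (m : ℕ) : Module.End ℝ (MS (m + 1)) :=
  op (m + 1)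
    ((MvPolynomial.aeval (fun i : Fin (m + 1) =>
        if i = Fin.last m then 0 else X i) : Pm (m + 1) →ₐ[ℝ] Pm (m + 1)).toLinearMap)
    LinearMap.id

/-- s-vectors of the subalgebra Cl(0,m-1) generated by e₁,…,e_{m-1}. -/
def clGradeU (m s : ℕ) : Submodule ℝ (Cl (m + 1)) :=
  Submodule.span ℝ
    {x | ∃ l : List (Fin m), l.length = s ∧ l.Nodup ∧
      x = (l.map (fun j => e (m + 1) (Fin.castSucc j))).prod}

/-- ∂̲⁺, the exterior Dirac operator in the first m variables. -/
def dplusU (m : ℕ) : Module.End ℝ (MS (m + 1)) :=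
  ∑ j : Fin m, op (m + 1) (pderiv (Fin.castSucc j)).toLinearMap
    (wedgeL (m + 1) (e (m + 1) (Fin.castSucc j)))

/-- ∂̲⁻, the interior Dirac operator in the first m variables. -/
def dminusU (m : ℕ) : Module.End ℝ (MS (m + 1)) :=
  ∑ j : Fin m, op (m + 1) (pderiv (Fin.castSucc j)).toLinearMap
    (dotL (m + 1) (e (m + 1) (Fin.castSucc j)))

set_option linter.unusedSimpArgs false

theorem e_sq (m : ℕ) (i : Fin m) : e m i * e m i = -1 := by
  unfold e
  rw [CliffordAlgebra.ι_sq_scalar]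
  have : Qf m (Pi.single i 1) = -1 := by
    simp [Qf, QuadraticMap.weightedSumSquares_apply, Pi.single_apply]
  rw [this]; simp

theorem e_anti (m : ℕ) {i j : Fin m} (h : i ≠ j) : e m i * e m j = -(e m j * e m i) := by
  unfold e
  apply CliffordAlgebra.ι_mul_ι_comm_of_isOrtho
  simp only [QuadraticMap.isOrtho_def, Qf, _root_.neg_apply,
    QuadraticMap.weightedSumSquares_apply]
  rw [← neg_add, ← Finset.sum_add_distrib]
  congr 1
  apply Finset.sum_congr rfl
  intro k _
  by_cases h1 : k = i
  · subst h1; simp [h]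
  · simp [h1]

theorem inv_e (m : ℕ) (i : Fin m) : involute (e m i) = - e m i := by
  unfold e; simp

theorem wedge_apply (m : ℕ) (c x : Cl m) :
    wedgeL m c x = (1/2 : ℝ) • (c * x + involute x * c) := by
  simp [wedgeL]

theorem dot_apply (m : ℕ) (c x : Cl m) :
    dotL m c x = (1/2 : ℝ) • (c * x - involute x * c) := by
  simp [dotL]

/-- moving a generator across a product of other generators -/
theorem e_prod (m : ℕ) (i : Fin m) (l : List (Fin m)) (h : i ∉ l) :
    involute (l.map (e m)).prod * e m i = e m i * (l.map (e m)).prod := by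
  induction l with
  | nil => simp
  | cons a l ih =>
    simp only [List.mem_cons, not_or] at h
    simp only [List.map_cons, List.prod_cons, map_mul, inv_e]
    rw [mul_assoc, ih h.2, ← mul_assoc, neg_mul, ← e_anti m h.1, mul_assoc]

theorem inv_prod (m : ℕ) (l : List (Fin m)) :
    involute (l.map (e m)).prod = (-1 : ℝ) ^ l.length • (l.map (e m)).prod := by
  induction l with
  | nil => simp
  | cons a l ih =>
    simp only [List.map_cons, List.prod_cons, map_mul, inv_e, ih, List.length_cons, pow_succ]
    simp

theorem rev_prod (m : ℕ) (l : List (Fin m)) (h : l.Nodup) :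
    reverse (l.map (e m)).prod = (-1 : ℝ) ^ (l.length.choose 2) • (l.map (e m)).prod := by
  induction l with
  | nil => simp
  | cons a l ih =>
    rw [List.nodup_cons] at h
    have h1 := e_prod m a l h.1
    rw [inv_prod] at h1
    have h2 : reverse (e m a) = e m a := by unfold e; simp
    simp only [List.map_cons, List.prod_cons, reverse.map_mul, ih h.2, List.length_cons, h2]
    rw [← h1, Nat.choose_succ_succ' _ 1, Nat.choose_one_right, pow_add]
    simp only [smul_mul_assoc, smul_smul]
    congr 1
    have : (-1 : ℝ) ^ l.length * (-1 : ℝ) ^ l.length = 1 := by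
      rw [← mul_pow]; simp
    rw [mul_right_comm, this, one_mul]

theorem grade_inv {m s : ℕ} {x : Cl m} (hx : x ∈ clGrade m s) :
    involute x = (-1 : ℝ) ^ s • x := by
  induction hx using Submodule.span_induction with
  | mem x h => obtain ⟨l, hl, hn, rfl⟩ := h; rw [inv_prod, hl]
  | zero => simp
  | add x y _ _ hx hy => rw [map_add, hx, hy, smul_add]
  | smul c x _ hx => rw [map_smul, hx, smul_comm]

theorem grade_rev {m s : ℕ} {x : Cl m} (hx : x ∈ clGrade m s) :
    reverse x = (-1 : ℝ) ^ (s.choose 2) • x := by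
  induction hx using Submodule.span_induction with
  | mem x h => obtain ⟨l, hl, hn, rfl⟩ := h; rw [rev_prod m l hn, hl]
  | zero => simp
  | add x y _ _ hx hy => rw [map_add, hx, hy, smul_add]
  | smul c x _ hx => rw [map_smul, hx, smul_comm]

theorem gradeU_comm {m s : ℕ} {x : Cl (m + 1)} (hx : x ∈ clGradeU m s) :
    involute x * e (m + 1) (Fin.last m) = e (m + 1) (Fin.last m) * x := by
  induction hx using Submodule.span_induction with
  | mem x h =>
    obtain ⟨l, hl, hn, rfl⟩ := h
    have := e_prod (m + 1) (Fin.last m) (l.map Fin.castSucc) (by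
      simp only [List.mem_map, not_exists, not_and]
      intro j _ hj
      exact absurd hj (Fin.castSucc_lt_last j).ne)
    simpa [List.map_map, Function.comp_def] using this
  | zero => simp
  | add x y _ _ hx hy => rw [map_add, add_mul, hx, hy, mul_add]
  | smul c x _ hx => rw [map_smul, smul_mul_assoc, hx, mul_smul_comm]

theorem op_congr {m : ℕ} {A : Type*} [AddCommGroup A] [Module ℝ A] (f : A →ₗ[ℝ] Pm m)
    (S : Submodule ℝ (Cl m)) (g h : Cl m →ₗ[ℝ] Cl m) (hgh : ∀ x ∈ S, g x = h x)
    {x : MS m} (hx : x ∈ LinearMap.range (TensorProduct.map f S.subtype)) :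
    op m LinearMap.id g x = op m LinearMap.id h x := by
  obtain ⟨y, rfl⟩ := hx
  induction y using TensorProduct.induction_on with
  | zero => simp
  | tmul a b => simp [op, hgh b b.2]
  | add a b ha hb => simp only [map_add, ha, hb]

theorem op_op (m : ℕ) (f f' : Pm m →ₗ[ℝ] Pm m) (g g' : Cl m →ₗ[ℝ] Cl m) (x : MS m) :
    op m f g (op m f' g' x) = op m (f ∘ₗ f') (g ∘ₗ g') x := by
  simp only [op, TensorProduct.map_comp, LinearMap.comp_apply]

theorem op_add (m : ℕ) (f : Pm m →ₗ[ℝ] Pm m) (g h : Cl m →ₗ[ℝ] Cl m) (x : MS m) :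
    op m f (g + h) x = op m f g x + op m f h x := by
  simp [op, TensorProduct.map_add_right]

theorem op_smul (m : ℕ) (f : Pm m →ₗ[ℝ] Pm m) (c : ℝ) (g : Cl m →ₗ[ℝ] Cl m) (x : MS m) :
    op m f (c • g) x = c • op m f g x := by
  simp [op, TensorProduct.map_smul_right]

theorem op_zero (m : ℕ) (f : Pm m →ₗ[ℝ] Pm m) (x : MS m) : op m f 0 x = 0 := by
  simp [op]

theorem op_id (m : ℕ) (x : MS m) : op m LinearMap.id LinearMap.id x = x := by
  simp [op]

theorem op_neg (m : ℕ) (f : Pm m →ₗ[ℝ] Pm m) (g : Cl m →ₗ[ℝ] Cl m) (x : MS m) :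
    op m f (-g) x = - op m f g x := by
  have h := op_add m f (-g) g x
  rw [neg_add_cancel, op_zero] at h
  exact eq_neg_of_add_eq_zero_left h.symm

/-- an operator anticommuting with all coefficients anticommutes with the sum -/
theorem sum_anti {m : ℕ} {ι : Type*} [Fintype ι] (f : ι → (Pm m →ₗ[ℝ] Pm m))
    (g : ι → (Cl m →ₗ[ℝ] Cl m)) (h : Cl m →ₗ[ℝ] Cl m)
    (H : ∀ j, h ∘ₗ g j = -(g j ∘ₗ h)) (x : MS m) :
    op m LinearMap.id h ((∑ j, op m (f j) (g j)) x) =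
      -((∑ j, op m (f j) (g j)) (op m LinearMap.id h x)) := by
  simp only [LinearMap.sum_apply, map_sum, op_op, H, op_neg, Finset.sum_neg_distrib]
  rfl

theorem WW (m : ℕ) {i j : Fin m} (h : i ≠ j) :
    wedgeL m (e m i) ∘ₗ wedgeL m (e m j) = -(wedgeL m (e m j) ∘ₗ wedgeL m (e m i)) := by
  ext1 x
  simp only [LinearMap.comp_apply, LinearMap.neg_apply, wedge_apply, map_smul, map_add, map_mul,
    inv_e, involute_involute, mul_smul_comm, smul_mul_assoc, mul_add, add_mul, ← mul_assoc]
  have h' : ∀ y, e m i * (e m j * y) = -(e m j * (e m i * y)) := fun y => by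
    rw [← mul_assoc, e_anti m h, neg_mul, mul_assoc]
  simp only [mul_assoc, neg_mul, mul_neg, e_anti m h, h']
  module

theorem DD (m : ℕ) {i j : Fin m} (h : i ≠ j) :
    dotL m (e m i) ∘ₗ dotL m (e m j) = -(dotL m (e m j) ∘ₗ dotL m (e m i)) := by
  ext1 x
  simp only [LinearMap.comp_apply, LinearMap.neg_apply, dot_apply, map_smul, map_sub, map_mul,
    inv_e, involute_involute, mul_smul_comm, smul_mul_assoc, mul_sub, sub_mul, ← mul_assoc]
  have h' : ∀ y, e m i * (e m j * y) = -(e m j * (e m i * y)) := fun y => by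
    rw [← mul_assoc, e_anti m h, neg_mul, mul_assoc]
  simp only [mul_assoc, neg_mul, mul_neg, e_anti m h, h']
  module

theorem DW (m : ℕ) {i j : Fin m} (h : i ≠ j) :
    dotL m (e m i) ∘ₗ wedgeL m (e m j) = -(wedgeL m (e m j) ∘ₗ dotL m (e m i)) := by
  ext1 x
  simp only [LinearMap.comp_apply, LinearMap.neg_apply, dot_apply, wedge_apply, map_smul, map_sub,
    map_add, map_mul,
    inv_e, involute_involute, mul_smul_comm, smul_mul_assoc, mul_sub, sub_mul, mul_add, add_mul,
    ← mul_assoc]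
  have h' : ∀ y, e m i * (e m j * y) = -(e m j * (e m i * y)) := fun y => by
    rw [← mul_assoc, e_anti m h, neg_mul, mul_assoc]
  simp only [mul_assoc, neg_mul, mul_neg, e_anti m h, h']
  module

theorem W_sq (m : ℕ) (i : Fin m) : wedgeL m (e m i) ∘ₗ wedgeL m (e m i) = 0 := by
  ext1 x
  simp only [LinearMap.comp_apply, LinearMap.zero_apply, wedge_apply, map_smul, map_add, map_mul,
    inv_e, involute_involute, mul_smul_comm, smul_mul_assoc, mul_add, add_mul]
  simp only [mul_assoc, neg_mul, mul_neg, e_sq]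
  simp only [← mul_assoc, e_sq]
  simp only [mul_assoc, neg_mul, mul_neg, one_mul, mul_one]
  module

theorem D_sq (m : ℕ) (i : Fin m) : dotL m (e m i) ∘ₗ dotL m (e m i) = 0 := by
  ext1 x
  simp only [LinearMap.comp_apply, LinearMap.zero_apply, dot_apply, map_smul, map_sub, map_mul,
    inv_e, involute_involute, mul_smul_comm, smul_mul_assoc, mul_sub, sub_mul]
  simp only [mul_assoc, neg_mul, mul_neg, e_sq]
  simp only [← mul_assoc, e_sq]
  simp only [mul_assoc, neg_mul, mul_neg, one_mul, mul_one]
  module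

theorem DW_WD (m : ℕ) (i : Fin m) : dotL m (e m i) ∘ₗ wedgeL m (e m i) +
    wedgeL m (e m i) ∘ₗ dotL m (e m i) = -LinearMap.id := by
  ext1 x
  simp only [LinearMap.comp_apply, LinearMap.add_apply, LinearMap.neg_apply, LinearMap.id_apply,
    dot_apply, wedge_apply, map_smul, map_sub, map_add, map_mul,
    inv_e, involute_involute, mul_smul_comm, smul_mul_assoc, mul_sub, sub_mul, mul_add, add_mul]
  simp only [mul_assoc, neg_mul, mul_neg, e_sq]
  simp only [← mul_assoc, e_sq]
  simp only [mul_assoc, neg_mul, mul_neg, one_mul, mul_one]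
  module

theorem inv_D (m : ℕ) (i : Fin m) :
    (involute (Q := Qf m)).toLinearMap ∘ₗ dotL m (e m i) =
      -(dotL m (e m i) ∘ₗ (involute (Q := Qf m)).toLinearMap) := by
  ext1 x
  simp only [LinearMap.comp_apply, LinearMap.neg_apply, dot_apply, map_smul, map_sub, map_mul,
    inv_e, involute_involute, AlgHom.toLinearMap_apply, neg_mul, mul_neg]
  module

/-- A graded monogenic polynomial solves both halves of the Hodge–de Rham system. -/
theorem split {m k s : ℕ} {p : MS m} (hp : p ∈ Pks m k s) (hD : Dirac m p = 0) :
    dplus m p = 0 ∧ dminus m p = 0 := by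
  have hinv : op m LinearMap.id (involute (Q := Qf m)).toLinearMap p = (-1 : ℝ) ^ s • p := by
    rw [op_congr _ _ _ ((-1 : ℝ) ^ s • LinearMap.id) (fun x hx => grade_inv hx) hp, op_smul, op_id]
  have hrev : op m LinearMap.id (reverse (Q := Qf m)) p = (-1 : ℝ) ^ (s.choose 2) • p := by
    rw [op_congr _ _ _ ((-1 : ℝ) ^ (s.choose 2) • LinearMap.id) (fun x hx => grade_rev hx) hp,
      op_smul, op_id]
  have hrc : ∀ j, (reverse (Q := Qf m)) ∘ₗ LinearMap.mulLeft ℝ (e m j) =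
      LinearMap.mulRight ℝ (e m j) ∘ₗ (reverse (Q := Qf m)) := by
    intro j
    ext1 x
    simp [e]
  have hR : ∑ j, op m (pderiv j).toLinearMap (LinearMap.mulRight ℝ (e m j)) p = 0 := by
    have h := congrArg (op m LinearMap.id (reverse (Q := Qf m))) hD
    simp only [Dirac, LinearMap.sum_apply, map_sum, op_op, hrc, map_zero] at h
    have h2 : ∀ j, op m (LinearMap.id ∘ₗ (pderiv j).toLinearMap)
        (LinearMap.mulRight ℝ (e m j) ∘ₗ (reverse (Q := Qf m))) p =
        (-1 : ℝ) ^ (s.choose 2) •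
          op m (pderiv j).toLinearMap (LinearMap.mulRight ℝ (e m j)) p := by
      intro j
      rw [← map_smul, ← hrev, op_op]; rfl
    simp only [h2, ← Finset.smul_sum] at h
    exact (smul_eq_zero.mp h).resolve_left (by simp)
  have hRi : ∑ j, op m (pderiv j).toLinearMap
      (LinearMap.mulRight ℝ (e m j) ∘ₗ (involute (Q := Qf m)).toLinearMap) p = 0 := by
    have h2 : ∀ j : Fin m, op m (pderiv j).toLinearMap
        (LinearMap.mulRight ℝ (e m j) ∘ₗ (involute (Q := Qf m)).toLinearMap) p =
        (-1 : ℝ) ^ s •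
          op m (pderiv j).toLinearMap (LinearMap.mulRight ℝ (e m j)) p := by
      intro j
      rw [← map_smul, ← hinv, op_op]; rfl
    simp only [h2, ← Finset.smul_sum, hR, smul_zero]
  simp only [Dirac, LinearMap.sum_apply] at hD
  constructor
  · simp only [dplus, wedgeL, LinearMap.sum_apply, op_smul, op_add, ← Finset.smul_sum,
      Finset.sum_add_distrib, hD, hRi, add_zero, smul_zero]
  · simp only [dminus, dotL, LinearMap.sum_apply, op_smul, sub_eq_add_neg, op_add, op_neg,
      ← Finset.smul_sum,
      Finset.sum_add_distrib, Finset.sum_neg_distrib, hD, hRi, add_zero, smul_zero, neg_zero]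

theorem ev_pderiv (m : ℕ) (j : Fin m) :
    ((MvPolynomial.aeval (fun i : Fin (m + 1) =>
        if i = Fin.last m then 0 else X i) : Pm (m + 1) →ₐ[ℝ] Pm (m + 1)).toLinearMap) ∘ₗ
      (pderiv (R := ℝ) (Fin.castSucc j)).toLinearMap =
    (pderiv (R := ℝ) (Fin.castSucc j)).toLinearMap ∘ₗ
     ((MvPolynomial.aeval (fun i : Fin (m + 1) =>
        if i = Fin.last m then 0 else X i) : Pm (m + 1) →ₐ[ℝ] Pm (m + 1)).toLinearMap) := by
  refine LinearMap.ext fun q => ?_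
  change aeval _ (pderiv (Fin.castSucc j) q) = pderiv (Fin.castSucc j) (aeval _ q)
  induction q using MvPolynomial.induction_on with
  | C a => simp
  | add p q hp hq => simp only [map_add, hp, hq]
  | mul_X p i hp =>
    simp only [Derivation.leibniz, map_mul, map_add, smul_eq_mul, hp, aeval_X]
    congr 2
    by_cases hi : i = Fin.last m
    · subst hi
      simp [pderiv_X, Pi.single_apply, (Fin.castSucc_lt_last j).ne']
    · by_cases hij : i = Fin.castSucc j
      · subst hij; simp [hi]
      · simp [hi, pderiv_X, Pi.single_apply, hij]

/-- If `Σ ∂_j ⊗ g_j` kills `p`, restrict to the hyperplane and apply a `g_m` that squares to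
zero and anticommutes with the others. -/
theorem restrict {m : ℕ} (g : Fin (m + 1) → (Cl (m + 1) →ₗ[ℝ] Cl (m + 1))) (p : MS (m + 1))
    (hp : (∑ j, op (m + 1) (pderiv j).toLinearMap (g j)) p = 0)
    (hsq : g (Fin.last m) ∘ₗ g (Fin.last m) = 0) :
    op (m + 1) LinearMap.id (g (Fin.last m))
      ((∑ j : Fin m, op (m + 1) (pderiv (Fin.castSucc j)).toLinearMap (g (Fin.castSucc j)))
        (Ev0 m p)) = 0 := by
  have h := congrArg (fun t => op (m + 1) LinearMap.id (g (Fin.last m)) (Ev0 m t)) hp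
  rw [Fin.sum_univ_castSucc] at h
  simp only [map_zero, LinearMap.add_apply, LinearMap.sum_apply, map_sum, map_add] at h
  simp only [LinearMap.sum_apply, map_sum]
  simp only [Ev0, op_op, LinearMap.id_comp, LinearMap.comp_id, hsq, op_zero, add_zero,
    ev_pderiv] at h ⊢
  exact h

/-- if p is a k-homogeneous Cl^s-valued monogenic polynomial and its
restriction to x_m = 0 is written as p₀ = u₀ + v₀ e_m with u₀ s-vector valued and v₀
(s-1)-vector valued over e₁,…,e_{m-1}, then ∂̲⁺u₀ = 0 and ∂̲⁻v₀ = 0. -/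
theorem stmt17 (m k s : ℕ) (p : MS (m + 1))
    (hp : p ∈ Pks (m + 1) k s) (hmono : Dirac (m + 1) p = 0)
    (u₀ v₀ : MS (m + 1))
    (hu : u₀ ∈ LinearMap.range (TensorProduct.map
      (LinearMap.id : Pm (m + 1) →ₗ[ℝ] Pm (m + 1)) (clGradeU m s).subtype))
    (hv : v₀ ∈ LinearMap.range (TensorProduct.map
      (LinearMap.id : Pm (m + 1) →ₗ[ℝ] Pm (m + 1)) (clGradeU m (s - 1)).subtype))
    (hdec : Ev0 m p = u₀ +
      (op (m + 1) LinearMap.id (LinearMap.mulRight ℝ (e (m + 1) (Fin.last m)))) v₀) :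
    dplusU m u₀ = 0 ∧ dminusU m v₀ = 0 := by
  have hne : ∀ j : Fin m, Fin.last m ≠ Fin.castSucc j := fun j => (Fin.castSucc_lt_last j).ne'
  obtain ⟨h1, h2⟩ := split hp hmono
  have r1 := restrict (fun j => wedgeL (m + 1) (e (m + 1) j)) p h1 (W_sq _ _)
  have r2 := restrict (fun j => dotL (m + 1) (e (m + 1) j)) p h2 (D_sq _ _)
  have hDu : op (m + 1) LinearMap.id (dotL (m + 1) (e (m + 1) (Fin.last m))) u₀ = 0 := by
    rw [op_congr _ _ _ 0 (fun x hx => ?_) hu, op_zero]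
    rw [dot_apply, gradeU_comm hx]; simp
  have hWv : op (m + 1) LinearMap.id (wedgeL (m + 1) (e (m + 1) (Fin.last m)))
      (op (m + 1) LinearMap.id (LinearMap.mulRight ℝ (e (m + 1) (Fin.last m))) v₀) = 0 := by
    rw [op_op, LinearMap.id_comp, op_congr _ _ _ 0 (fun x hx => ?_) hv, op_zero]
    simp only [LinearMap.comp_apply, wedge_apply, LinearMap.mulRight_apply, map_mul, inv_e,
      mul_neg, neg_mul, LinearMap.zero_apply]
    rw [gradeU_comm hx, mul_assoc]; simp
  have hDv : op (m + 1) LinearMap.id (dotL (m + 1) (e (m + 1) (Fin.last m)))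
      (op (m + 1) LinearMap.id (LinearMap.mulRight ℝ (e (m + 1) (Fin.last m))) v₀) =
      - op (m + 1) LinearMap.id (involute (Q := Qf (m + 1))).toLinearMap v₀ := by
    rw [op_op, LinearMap.id_comp, ← op_neg]
    refine op_congr _ _ _ _ (fun x hx => ?_) hv
    simp only [LinearMap.comp_apply, dot_apply, LinearMap.mulRight_apply, map_mul, inv_e,
      mul_neg, neg_mul, LinearMap.neg_apply, AlgHom.toLinearMap_apply]
    rw [← mul_assoc, ← gradeU_comm hx, mul_assoc, e_sq, mul_neg_one]
    module
  rw [sum_anti _ _ _ (fun j => WW _ (hne j)), hdec, map_add, hWv, add_zero,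
    ← sum_anti _ _ _ (fun j => WW _ (hne j))] at r1
  rw [sum_anti _ _ _ (fun j => DD _ (hne j)), hdec, map_add, hDu, zero_add, hDv, map_neg, neg_neg]
    at r2
  constructor
  · have h3 : op (m + 1) LinearMap.id (dotL (m + 1) (e (m + 1) (Fin.last m))) (dplusU m u₀) = 0 := by
      unfold dplusU
      rw [sum_anti _ _ _ (fun j => DW _ (hne j)), hDu, map_zero, neg_zero]
    have h4 := congrArg (fun t => op (m + 1) LinearMap.id t (dplusU m u₀))
      (DW_WD (m + 1) (Fin.last m))
    have r1' : op (m + 1) LinearMap.id (wedgeL (m + 1) (e (m + 1) (Fin.last m)))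
      (dplusU m u₀) = 0 := r1
    simp only [op_add, op_neg, op_id] at h4
    rw [← LinearMap.id_comp (LinearMap.id : Pm (m + 1) →ₗ[ℝ] Pm (m + 1)), ← op_op, ← op_op,
      h3, r1', map_zero, map_zero, add_zero] at h4
    exact neg_eq_zero.mp h4.symm
  · have h3 : op (m + 1) LinearMap.id (involute (Q := Qf (m + 1))).toLinearMap (dminusU m v₀)
        = 0 := by
      unfold dminusU
      rw [sum_anti _ _ _ (fun j => inv_D _ _), r2, neg_zero]
    have h4 := congrArg (op (m + 1) LinearMap.id (involute (Q := Qf (m + 1))).toLinearMap) h3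
    rw [op_op, map_zero] at h4
    have h5 : (involute (Q := Qf (m + 1))).toLinearMap ∘ₗ (involute (Q := Qf (m + 1))).toLinearMap
        = LinearMap.id := by
      ext1 x; simp
    rwa [h5, LinearMap.id_comp, op_id] at h4

end
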